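/- Corruption error bound (equation (116) in the proof of Theorem 1). Fix β = 1 and fix V* : S → [0, R_max/(1−γ)]. Define the policies π_E(a|s) = π_μ(a|s)·exp([T V*](s,a) − V*(s)) / Z(s) and π̃_E(a|s) = π_D(a|s)·exp([T̃ V*](s,a) − V*(s)) / Z̃(s), where Z(s) and Z̃(s) are the normalizing constants making these probability mass functions on A. Assume for each i = 1,…,N there exist ζ_i ≥ 0 and ζ'_i ≥ 1 such that for every V : S → [0, R_max/(1−γ)] and every a ∈ A one has |[T V](s_i,a) − [T̃ V](s_i,a)| ≤ ζ_i, and max(π_D(a|s_i)/π_μ(a|s_i), π_μ(a|s_i)/π_D(a|s_i)) ≤ ζ'_i; set ζ = Σ_{i=1}^N (2ζ_i + log ζ'_i). Assume there exists M > 0 such that d^{π̃_E}(s,a) ≤ M·d_D(s,a) for all (s,a). Then for any initial distribution ρ0 on S, V^{π_E}(ρ0) − V^{π̃_E}(ρ0) ≤ (2R_max/(1−γ)²)·√(Mζ/N). -/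

import Mathlib

open Finset

theorem abs_sub_le_mul_log_of_le_mul {p q C : ℝ} (hp : 0 < p) (hq : 0 < q)
    (hpq : p ≤ C * q) (hqp : q ≤ C * p) : |p - q| ≤ (p + q) / 2 * Real.log C := by
  wlog h : q ≤ p generalizing p q
  · rw [abs_sub_comm, add_comm]
    exact this hq hp hqp hpq (le_of_not_ge h)
  have hx : 0 ≤ p / q - 1 := by
    rw [sub_nonneg, le_div_iff₀ hq]; linarith
  have hlog := Real.le_log_one_add_of_nonneg hx
  have hC : Real.log (1 + (p / q - 1)) ≤ Real.log C := by
    apply Real.log_le_log (by linarith)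
    rw [add_sub_cancel, div_le_iff₀ hq]
    exact hpq
  have heq : 2 * (p / q - 1) / (p / q - 1 + 2) = 2 * (p - q) / (p + q) := by
    have : p / q - 1 + 2 ≠ 0 := by linarith
    have : p + q ≠ 0 := by linarith
    rw [div_eq_div_iff ‹_› ‹_›]
    field_simp
    ring
  rw [heq] at hlog
  have := hlog.trans hC
  rw [div_le_iff₀ (by linarith)] at this
  rw [abs_of_nonneg (by linarith)]
  linarith

theorem sq_sum_abs_sub_le_two_mul_log {A : Type*} [Fintype A] {p q : A → ℝ} {C : ℝ}
    (hp : ∀ a, 0 < p a) (hq : ∀ a, 0 < q a) (hp1 : ∑ a, p a = 1) (hq1 : ∑ a, q a = 1)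
    (hpq : ∀ a, p a ≤ C * q a) (hqp : ∀ a, q a ≤ C * p a) :
    (∑ a, |p a - q a|) ^ 2 ≤ 2 * Real.log C := by
  have h0 : 0 ≤ ∑ a, |p a - q a| := sum_nonneg fun a _ => abs_nonneg _
  have h2 : ∑ a, |p a - q a| ≤ 2 := by
    calc ∑ a, |p a - q a| ≤ ∑ a, (p a + q a) := sum_le_sum fun a _ => by
          rw [abs_le]; constructor <;> linarith [hp a, hq a]
      _ = 2 := by rw [sum_add_distrib, hp1, hq1]; norm_num
  have hL : ∑ a, |p a - q a| ≤ Real.log C := by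
    calc ∑ a, |p a - q a| ≤ ∑ a, (p a + q a) / 2 * Real.log C := sum_le_sum fun a _ =>
          abs_sub_le_mul_log_of_le_mul (hp a) (hq a) (hpq a) (hqp a)
      _ = Real.log C := by
          rw [← sum_mul, ← sum_div, sum_add_distrib, hp1, hq1]; norm_num
  nlinarith

theorem div_sum_le_sq_mul_div_sum {A : Type*} [Fintype A] [Nonempty A] {v w : A → ℝ} {c : ℝ}
    (hc : 0 ≤ c) (hv : ∀ a, 0 < v a) (hw : ∀ a, 0 < w a)
    (hvw : ∀ a, v a ≤ c * w a) (hwv : ∀ a, w a ≤ c * v a) (a : A) :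
    v a / ∑ b, v b ≤ c ^ 2 * (w a / ∑ b, w b) := by
  have hV : 0 < ∑ b, v b := sum_pos (fun b _ => hv b) univ_nonempty
  have hW : 0 < ∑ b, w b := sum_pos (fun b _ => hw b) univ_nonempty
  have hWV : ∑ b, w b ≤ c * ∑ b, v b := by
    rw [mul_sum]; exact sum_le_sum fun b _ => hwv b
  rw [← mul_div_assoc, div_le_div_iff₀ hV hW]
  calc v a * ∑ b, w b ≤ (c * w a) * (c * ∑ b, v b) :=
        mul_le_mul (hvw a) hWV hW.le (mul_nonneg hc (hw a).le)
    _ = c ^ 2 * w a * ∑ b, v b := by ring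

section MarkovChain

variable {S : Type*} [Fintype S] {K : S → S → ℝ} {γ : ℝ} {ρ d : S → ℝ}

theorem discounted_occupancy_nonneg (hK0 : ∀ s s', 0 ≤ K s s') (hK1 : ∀ s, ∑ s', K s s' = 1)
    (hγ0 : 0 ≤ γ) (hγ1 : γ < 1) (hρ : ∀ s, 0 ≤ ρ s)
    (hd : ∀ s', d s' = (1 - γ) * ρ s' + γ * ∑ s, d s * K s s') (s : S) : 0 ≤ d s := by
  have hstep : ∀ s', (d s')⁻ ≤ γ * ∑ s, (d s)⁻ * K s s' := by
    intro s'
    have hsum : -∑ s, d s * K s s' ≤ ∑ s, (d s)⁻ * K s s' := by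
      rw [← sum_neg_distrib]
      refine sum_le_sum fun s _ => ?_
      rw [← neg_mul]
      exact mul_le_mul_of_nonneg_right (neg_le_negPart _) (hK0 _ _)
    rw [negPart_def, sup_le_iff]
    constructor
    · rw [hd s']
      nlinarith [mul_nonneg (sub_nonneg.2 hγ1.le) (hρ s'), mul_le_mul_of_nonneg_left hsum hγ0]
    · exact mul_nonneg hγ0 (sum_nonneg fun s _ => mul_nonneg (negPart_nonneg _) (hK0 _ _))
  have htot : ∑ s, (d s)⁻ ≤ γ * ∑ s, (d s)⁻ := by
    calc ∑ s', (d s')⁻ ≤ ∑ s', γ * ∑ s, (d s)⁻ * K s s' := sum_le_sum fun s _ => hstep s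
      _ = γ * ∑ s, (d s)⁻ := by
          rw [← mul_sum, sum_comm]
          simp only [← mul_sum, hK1, mul_one]
  have hle : (d s)⁻ ≤ ∑ s, (d s)⁻ :=
    single_le_sum (f := fun s => (d s)⁻) (fun s _ => negPart_nonneg _) (mem_univ s)
  have : (d s)⁻ ≤ 0 := by nlinarith
  linarith [neg_le_negPart (d s)]

theorem one_sub_mul_sum_eq_of_bellman {D g : S → ℝ}
    (hd : ∀ s', d s' = (1 - γ) * ρ s' + γ * ∑ s, d s * K s s')
    (hD : ∀ s, D s = g s + γ * ∑ s', K s s' * D s') :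
    (1 - γ) * ∑ s, ρ s * D s = ∑ s, d s * g s := by
  have h1 : ∑ s, d s * D s = ∑ s, d s * g s + γ * ∑ s, ∑ s', d s * K s s' * D s' := by
    rw [mul_sum, ← sum_add_distrib]
    refine sum_congr rfl fun s _ => ?_
    conv_lhs => rw [hD s]
    simp only [mul_add, mul_assoc, mul_sum, mul_left_comm]
  have h2 : ∑ s, d s * D s
      = (1 - γ) * ∑ s, ρ s * D s + γ * ∑ s, ∑ s', d s * K s s' * D s' := by
    rw [sum_comm, mul_sum, mul_sum, ← sum_add_distrib]
    refine sum_congr rfl fun s _ => ?_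
    conv_lhs => rw [hd s]
    simp only [← sum_mul]
    ring
  linarith

theorem discounted_occupancy_sum_eq_one (hK1 : ∀ s, ∑ s', K s s' = 1) (hγ1 : γ < 1)
    (hρ1 : ∑ s, ρ s = 1)
    (hd : ∀ s', d s' = (1 - γ) * ρ s' + γ * ∑ s, d s * K s s') : ∑ s, d s = 1 := by
  have h := one_sub_mul_sum_eq_of_bellman (D := fun _ => 1) (g := fun _ => 1 - γ) hd
    (fun s => by simp [hK1])
  simp only [mul_one, hρ1, ← sum_mul] at h
  have : 1 - γ ≠ 0 := by linarith
  field_simp at h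
  exact h.symm

end MarkovChain

theorem abs_bellman_backup_le {S A : Type*} [Fintype S] {P : S → A → S → ℝ}
    (hP0 : ∀ s a s', 0 ≤ P s a s') (hP1 : ∀ s a, ∑ s', P s a s' = 1) {r : S → A → ℝ}
    {R γ B : ℝ} (hr : ∀ s a, |r s a| ≤ R) (hγ0 : 0 ≤ γ) {V : S → ℝ} (hV : ∀ s, |V s| ≤ B)
    (s : S) (a : A) : |r s a + γ * ∑ s', P s a s' * V s'| ≤ R + γ * B := by
  have h : |∑ s', P s a s' * V s'| ≤ B := by
    calc |∑ s', P s a s' * V s'| ≤ ∑ s', |P s a s' * V s'| := abs_sum_le_sum_abs _ _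
      _ ≤ ∑ s', P s a s' * B := sum_le_sum fun s' _ => by
          rw [abs_mul, abs_of_nonneg (hP0 s a s')]
          exact mul_le_mul_of_nonneg_left (hV s') (hP0 s a s')
      _ = B := by rw [← sum_mul, hP1, one_mul]
  refine (abs_add_le _ _).trans (add_le_add (hr s a) ?_)
  rw [abs_mul, abs_of_nonneg hγ0]
  exact mul_le_mul_of_nonneg_left h hγ0

theorem abs_value_le {S A : Type*} [Fintype S] [Fintype A] [Nonempty S] {P : S → A → S → ℝ}
    (hP0 : ∀ s a s', 0 ≤ P s a s') (hP1 : ∀ s a, ∑ s', P s a s' = 1) {r : S → A → ℝ}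
    {R γ : ℝ} (hr : ∀ s a, |r s a| ≤ R) (hγ0 : 0 ≤ γ) (hγ1 : γ < 1) {π : S → A → ℝ}
    (hπ0 : ∀ s a, 0 ≤ π s a) (hπ1 : ∀ s, ∑ a, π s a = 1) {V : S → ℝ}
    (hV : ∀ s, V s = ∑ a, π s a * (r s a + γ * ∑ s', P s a s' * V s')) (s : S) :
    |V s| ≤ R / (1 - γ) := by
  obtain ⟨m, hm⟩ := Finite.exists_max fun s => |V s|
  have h : |V m| ≤ R + γ * |V m| := by
    calc |V m| = |∑ a, π m a * (r m a + γ * ∑ s', P m a s' * V s')| := by rw [← hV m]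
      _ ≤ ∑ a, |π m a * (r m a + γ * ∑ s', P m a s' * V s')| := abs_sum_le_sum_abs _ _
      _ ≤ ∑ a, π m a * (R + γ * |V m|) := sum_le_sum fun a _ => by
          rw [abs_mul, abs_of_nonneg (hπ0 m a)]
          exact mul_le_mul_of_nonneg_left (abs_bellman_backup_le hP0 hP1 hr hγ0 hm m a)
            (hπ0 m a)
      _ = R + γ * |V m| := by rw [← sum_mul, hπ1, one_mul]
  refine (hm s).trans ?_
  rw [le_div_iff₀ (by linarith)]
  linarith

/-- Performance difference bound: the value gap of two policies is controlled by their
`L¹` distance averaged over the discounted occupancy of the second one. -/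
theorem sum_value_sub_le {S A : Type*} [Fintype S] [Fintype A] [Nonempty S]
    {P : S → A → S → ℝ} (hP0 : ∀ s a s', 0 ≤ P s a s') (hP1 : ∀ s a, ∑ s', P s a s' = 1)
    {r : S → A → ℝ} {R γ : ℝ} (hr : ∀ s a, |r s a| ≤ R) (hγ0 : 0 ≤ γ) (hγ1 : γ < 1)
    {π π' : S → A → ℝ} (hπ0 : ∀ s a, 0 ≤ π s a) (hπ1 : ∀ s, ∑ a, π s a = 1)
    {V V' : S → ℝ} (hV : ∀ s, V s = ∑ a, π s a * (r s a + γ * ∑ s', P s a s' * V s'))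
    (hV' : ∀ s, V' s = ∑ a, π' s a * (r s a + γ * ∑ s', P s a s' * V' s'))
    {ρ d : S → ℝ} (hd0 : ∀ s, 0 ≤ d s)
    (hd : ∀ s', d s' = (1 - γ) * ρ s' + γ * ∑ s, d s * ∑ a, π' s a * P s a s') :
    (∑ s, ρ s * V s) - ∑ s, ρ s * V' s ≤
      R / (1 - γ) ^ 2 * ∑ s, d s * ∑ a, |π s a - π' s a| := by
  have hγ : 0 < 1 - γ := by linarith
  have hD : ∀ s, V s - V' s = (∑ a, (π s a - π' s a) * (r s a + γ * ∑ s', P s a s' * V s'))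
      + γ * ∑ s', (∑ a, π' s a * P s a s') * (V s' - V' s') := by
    intro s
    have hswap : ∑ s', (∑ a, π' s a * P s a s') * (V s' - V' s')
        = ∑ a, π' s a * (∑ s', P s a s' * V s' - ∑ s', P s a s' * V' s') := by
      simp only [sum_mul, ← sum_sub_distrib, mul_sum]
      rw [sum_comm]
      exact sum_congr rfl fun _ _ => sum_congr rfl fun _ _ => by ring
    rw [hswap, hV s, hV' s, mul_sum, ← sum_sub_distrib, ← sum_add_distrib]
    exact sum_congr rfl fun _ _ => by ring
  have hdiff := one_sub_mul_sum_eq_of_bellman (D := fun s => V s - V' s) hd hD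
  have hQ : ∀ s a, |r s a + γ * ∑ s', P s a s' * V s'| ≤ R / (1 - γ) := by
    intro s a
    refine (abs_bellman_backup_le hP0 hP1 hr hγ0
      (abs_value_le hP0 hP1 hr hγ0 hγ1 hπ0 hπ1 hV) s a).trans (le_of_eq ?_)
    field_simp
    ring
  have hg : ∀ s, ∑ a, (π s a - π' s a) * (r s a + γ * ∑ s', P s a s' * V s')
      ≤ (∑ a, |π s a - π' s a|) * (R / (1 - γ)) := by
    intro s
    rw [sum_mul]
    refine sum_le_sum fun a _ => (le_abs_self _).trans ?_
    rw [abs_mul]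
    exact mul_le_mul_of_nonneg_left (hQ s a) (abs_nonneg _)
  have hle : (1 - γ) * ∑ s, ρ s * (V s - V' s)
      ≤ (∑ s, d s * ∑ a, |π s a - π' s a|) * (R / (1 - γ)) := by
    rw [hdiff, sum_mul]
    refine sum_le_sum fun s _ => ?_
    rw [mul_assoc]
    exact mul_le_mul_of_nonneg_left (hg s) (hd0 s)
  rw [← sum_sub_distrib]
  simp only [← mul_sub]
  rw [mul_comm, ← le_div_iff₀ hγ] at hle
  refine hle.trans (le_of_eq ?_)
  field_simp

theorem sum_empirical_mul {S A : Type*} [Fintype S] [Fintype A] [DecidableEq S] [DecidableEq A]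
    {N : ℕ} (sa : Fin N → S × A) {d : S → A → ℝ}
    (hd : ∀ s a, d s a = (∑ i, if sa i = (s, a) then (1 : ℝ) else 0) / N) (f : S → ℝ) :
    ∑ s, (∑ a, d s a) * f s = (∑ i, f (sa i).1) / N := by
  have h : ∀ s a, d s a * f s = (∑ i, if sa i = (s, a) then f (sa i).1 else 0) / N := by
    intro s a
    rw [hd, div_mul_eq_mul_div, sum_mul]
    congr 1
    refine sum_congr rfl fun i _ => ?_
    split_ifs with hi
    · rw [hi, one_mul]
    · rw [zero_mul]
  simp only [sum_mul, h, ← sum_div]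
  congr 1
  rw [← Fintype.sum_prod_type' (f := fun s a => ∑ i, if sa i = (s, a) then f (sa i).1 else 0),
    sum_comm]
  simp


/-- Corruption error bound (equation (116) in the proof of Theorem 1), with `β = 1`.
Under the cumulative corruption assumption and the coverage condition
`d^{π̃_E}(s,a) ≤ M·d_D(s,a)`, one has
`V^{π_E}(ρ0) − V^{π̃_E}(ρ0) ≤ (2R_max/(1−γ)²)·√(Mζ/N)`. -/
theorem corruption_error_bound
    {S A : Type*} [Fintype S] [Fintype A] [Nonempty S] [Nonempty A] [DecidableEq S] [DecidableEq A]
    -- true and corrupted transition kernels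
    (P Pt : S → A → S → ℝ)
    (hP_nonneg : ∀ s a s', 0 ≤ P s a s')
    (hP_sum : ∀ s a, ∑ s', P s a s' = 1)
    (hPt_nonneg : ∀ s a s', 0 ≤ Pt s a s')
    (hPt_sum : ∀ s a, ∑ s', Pt s a s' = 1)
    -- true and corrupted rewards
    (r rt : S → A → ℝ) (Rmax : ℝ) (hRmax : 0 < Rmax)
    (hr : ∀ s a, |r s a| ≤ Rmax)
    (γ : ℝ) (hγ0 : 0 ≤ γ) (hγ1 : γ < 1)
    -- fixed value function V*
    (Vstar : S → ℝ)
    (hVstar : ∀ s, 0 ≤ Vstar s ∧ Vstar s ≤ Rmax / (1 - γ))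
    -- behavior distribution μ and its conditional policy π_μ
    (μ : S → A → ℝ) (hμ_pos : ∀ s a, 0 < μ s a) (hμ_sum : ∑ s, ∑ a, μ s a = 1)
    (πμ : S → A → ℝ) (hπμ : ∀ s a, πμ s a = μ s a / ∑ b, μ s b)
    -- dataset, empirical distribution d_D, and its conditional policy π_D
    (N : ℕ) (hN : 0 < N) (sa : Fin N → S × A)
    (dD : S → A → ℝ)
    (hdD : ∀ s a, dD s a = (∑ i, if sa i = (s, a) then (1 : ℝ) else 0) / N)
    (hdD_pos : ∀ s a, 0 < dD s a)
    (πD : S → A → ℝ) (hπD : ∀ s a, πD s a = dD s a / ∑ b, dD s b)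
    -- the tilted policies π_E and π̃_E (β = 1)
    (πE πtE : S → A → ℝ)
    (hπE : ∀ s a, πE s a =
      πμ s a * Real.exp ((r s a + γ * ∑ s', P s a s' * Vstar s') - Vstar s) /
        ∑ b, πμ s b * Real.exp ((r s b + γ * ∑ s', P s b s' * Vstar s') - Vstar s))
    (hπtE : ∀ s a, πtE s a =
      πD s a * Real.exp ((rt s a + γ * ∑ s', Pt s a s' * Vstar s') - Vstar s) /
        ∑ b, πD s b * Real.exp ((rt s b + γ * ∑ s', Pt s b s' * Vstar s') - Vstar s))
    -- cumulative corruption assumption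
    (ζ ζ' : Fin N → ℝ)
    (hζ_nonneg : ∀ i, 0 ≤ ζ i) (hζ'_ge_one : ∀ i, 1 ≤ ζ' i)
    (hcorrupt : ∀ V : S → ℝ, (∀ s, 0 ≤ V s ∧ V s ≤ Rmax / (1 - γ)) →
      ∀ i a, |(r (sa i).1 a + γ * ∑ s', P (sa i).1 a s' * V s') -
        (rt (sa i).1 a + γ * ∑ s', Pt (sa i).1 a s' * V s')| ≤ ζ i)
    (hratio : ∀ i a, πD (sa i).1 a / πμ (sa i).1 a ≤ ζ' i ∧
      πμ (sa i).1 a / πD (sa i).1 a ≤ ζ' i)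
    -- initial distribution, occupancy of π̃_E, and coverage
    (ρ0 : S → ℝ) (hρ0_nonneg : ∀ s, 0 ≤ ρ0 s) (hρ0_sum : ∑ s, ρ0 s = 1)
    (dtE : S → ℝ)
    (hdtE : ∀ s', dtE s' = (1 - γ) * ρ0 s' + γ * ∑ s, ∑ a, dtE s * πtE s a * P s a s')
    (M : ℝ) (hM : 0 < M)
    (hcov : ∀ s a, dtE s * πtE s a ≤ M * dD s a)
    -- value functions of π_E and π̃_E in the true MDP
    (VE VtE : S → ℝ)
    (hVE : ∀ s, VE s = ∑ a, πE s a * (r s a + γ * ∑ s', P s a s' * VE s'))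
    (hVtE : ∀ s, VtE s = ∑ a, πtE s a * (r s a + γ * ∑ s', P s a s' * VtE s')) :
    (∑ s, ρ0 s * VE s) - (∑ s, ρ0 s * VtE s) ≤
      2 * Rmax / (1 - γ) ^ 2 *
        Real.sqrt (M * (∑ i, (2 * ζ i + Real.log (ζ' i))) / N) := by
  have hμS : ∀ s, 0 < ∑ b, μ s b := fun s => sum_pos (fun b _ => hμ_pos s b) univ_nonempty
  have hDS : ∀ s, 0 < ∑ b, dD s b := fun s => sum_pos (fun b _ => hdD_pos s b) univ_nonempty
  have hπμ0 : ∀ s a, 0 < πμ s a := fun s a => hπμ s a ▸ div_pos (hμ_pos s a) (hμS s)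
  have hπD0 : ∀ s a, 0 < πD s a := fun s a => hπD s a ▸ div_pos (hdD_pos s a) (hDS s)
  set w : S → A → ℝ := fun s a =>
    πμ s a * Real.exp ((r s a + γ * ∑ s', P s a s' * Vstar s') - Vstar s) with hw
  set wt : S → A → ℝ := fun s a =>
    πD s a * Real.exp ((rt s a + γ * ∑ s', Pt s a s' * Vstar s') - Vstar s) with hwt
  have hw0 : ∀ s a, 0 < w s a := fun s a => mul_pos (hπμ0 s a) (Real.exp_pos _)
  have hwt0 : ∀ s a, 0 < wt s a := fun s a => mul_pos (hπD0 s a) (Real.exp_pos _)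
  have hE : ∀ s a, πE s a = w s a / ∑ b, w s b := hπE
  have htE : ∀ s a, πtE s a = wt s a / ∑ b, wt s b := hπtE
  have hwS : ∀ s, 0 < ∑ b, w s b := fun s => sum_pos (fun b _ => hw0 s b) univ_nonempty
  have hwtS : ∀ s, 0 < ∑ b, wt s b := fun s => sum_pos (fun b _ => hwt0 s b) univ_nonempty
  have hE0 : ∀ s a, 0 < πE s a := fun s a => hE s a ▸ div_pos (hw0 s a) (hwS s)
  have htE0 : ∀ s a, 0 < πtE s a := fun s a => htE s a ▸ div_pos (hwt0 s a) (hwtS s)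
  have hE1 : ∀ s, ∑ a, πE s a = 1 := fun s => by
    simp only [hE, ← sum_div]; exact div_self (hwS s).ne'
  have htE1 : ∀ s, ∑ a, πtE s a = 1 := fun s => by
    simp only [htE, ← sum_div]; exact div_self (hwtS s).ne'
  have hK0 : ∀ s s', 0 ≤ ∑ a, πtE s a * P s a s' := fun s s' =>
    sum_nonneg fun a _ => mul_nonneg (htE0 s a).le (hP_nonneg s a s')
  have hK1 : ∀ s, ∑ s', ∑ a, πtE s a * P s a s' = 1 := fun s => by
    rw [sum_comm]
    simp only [← mul_sum, hP_sum, mul_one, htE1]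
  have hd : ∀ s', dtE s' = (1 - γ) * ρ0 s' + γ * ∑ s, dtE s * ∑ a, πtE s a * P s a s' := by
    simpa only [mul_sum, mul_assoc] using hdtE
  have hd0 := discounted_occupancy_nonneg hK0 hK1 hγ0 hγ1 hρ0_nonneg hd
  have hd1 := discounted_occupancy_sum_eq_one hK1 hγ1 hρ0_sum hd
  have hdM : ∀ s, dtE s ≤ M * ∑ a, dD s a := fun s => by
    calc dtE s = ∑ a, dtE s * πtE s a := by rw [← mul_sum, htE1, mul_one]
      _ ≤ ∑ a, M * dD s a := sum_le_sum fun a _ => hcov s a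
      _ = M * ∑ a, dD s a := (mul_sum _ _ _).symm
  set t : S → ℝ := fun s => ∑ a, |πE s a - πtE s a|
  have htζ : ∀ i, t (sa i).1 ^ 2 ≤ 4 * (2 * ζ i + Real.log (ζ' i)) := by
    intro i
    have hζ'0 : 0 < ζ' i := one_pos.trans_le (hζ'_ge_one i)
    have hc0 : 0 < ζ' i * Real.exp (ζ i) := mul_pos hζ'0 (Real.exp_pos _)
    have hc := fun a => abs_le.1 (hcorrupt Vstar hVstar i a)
    have h1 : ∀ a, w (sa i).1 a ≤ ζ' i * Real.exp (ζ i) * wt (sa i).1 a := fun a => by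
      have h := (div_le_iff₀ (hπD0 _ a)).1 (hratio i a).2
      simp only [hw, hwt]
      rw [mul_mul_mul_comm, ← Real.exp_add]
      exact mul_le_mul h (Real.exp_le_exp.2 (by linarith [(hc a).2])) (Real.exp_pos _).le
        (mul_pos hζ'0 (hπD0 _ a)).le
    have h2 : ∀ a, wt (sa i).1 a ≤ ζ' i * Real.exp (ζ i) * w (sa i).1 a := fun a => by
      have h := (div_le_iff₀ (hπμ0 _ a)).1 (hratio i a).1
      simp only [hw, hwt]
      rw [mul_mul_mul_comm, ← Real.exp_add]
      exact mul_le_mul h (Real.exp_le_exp.2 (by linarith [(hc a).1])) (Real.exp_pos _).le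
        (mul_pos hζ'0 (hπμ0 _ a)).le
    have h := sq_sum_abs_sub_le_two_mul_log (C := (ζ' i * Real.exp (ζ i)) ^ 2)
      (hE0 (sa i).1) (htE0 (sa i).1) (hE1 _) (htE1 _)
      (fun a => by
        rw [hE, htE]; exact div_sum_le_sq_mul_div_sum hc0.le (hw0 _) (hwt0 _) h1 h2 a)
      (fun a => by
        rw [hE, htE]; exact div_sum_le_sq_mul_div_sum hc0.le (hwt0 _) (hw0 _) h2 h1 a)
    rw [Real.log_pow, Real.log_mul hζ'0.ne' (Real.exp_pos _).ne', Real.log_exp] at h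
    push_cast at h
    linarith [hζ_nonneg i]
  have hsq : (∑ s, dtE s * t s) ^ 2 ≤ 4 * (M * (∑ i, (2 * ζ i + Real.log (ζ' i))) / N) := by
    calc (∑ s, dtE s * t s) ^ 2 ≤ ∑ s, dtE s * t s ^ 2 := by
          simpa only [smul_eq_mul] using (even_two.convexOn_pow (𝕜 := ℝ)).map_sum_le
            (t := univ) (w := dtE) (p := t) (fun s _ => hd0 s) hd1 (fun _ _ => Set.mem_univ _)
      _ ≤ ∑ s, (M * ∑ a, dD s a) * t s ^ 2 := sum_le_sum fun s _ =>
          mul_le_mul_of_nonneg_right (hdM s) (sq_nonneg _)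
      _ = M * ((∑ i, t (sa i).1 ^ 2) / N) := by
          rw [← sum_empirical_mul sa hdD fun s => t s ^ 2, mul_sum]
          exact sum_congr rfl fun _ _ => mul_assoc _ _ _
      _ ≤ M * ((∑ i, 4 * (2 * ζ i + Real.log (ζ' i))) / N) := by
          gcongr with i
          exact htζ i
      _ = 4 * (M * (∑ i, (2 * ζ i + Real.log (ζ' i))) / N) := by
          rw [← mul_sum]; ring
  have hbound : ∑ s, dtE s * t s
      ≤ 2 * Real.sqrt (M * (∑ i, (2 * ζ i + Real.log (ζ' i))) / N) := by
    refine (Real.le_sqrt_of_sq_le hsq).trans (le_of_eq ?_)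
    rw [Real.sqrt_mul (by norm_num), show (4 : ℝ) = 2 ^ 2 by norm_num,
      Real.sqrt_sq (by norm_num)]
  calc (∑ s, ρ0 s * VE s) - (∑ s, ρ0 s * VtE s)
      ≤ Rmax / (1 - γ) ^ 2 * ∑ s, dtE s * t s :=
        sum_value_sub_le hP_nonneg hP_sum hr hγ0 hγ1 (fun s a => (hE0 s a).le) hE1 hVE hVtE
          hd0 hd
    _ ≤ Rmax / (1 - γ) ^ 2 * (2 * Real.sqrt (M * (∑ i, (2 * ζ i + Real.log (ζ' i))) / N)) := by
        gcongr
    _ = _ := by ring
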